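/- Let n ≥ 2 be an odd integer (so n ≥ 3). Then in the dicyclic group Dic_{4n}: the number of MSTD subsets of cardinality 2 is S_{Dic_{4n}}(2) = 4n(n−1), the number of MDTS subsets of cardinality 2 is D_{Dic_{4n}}(2) = 0, and the number of balanced subsets of cardinality 2 is B_{Dic_{4n}}(2) = 2n(2n+1). -/

import Mathlib

open Finset Pointwise

/-- A finset of a group is MSTD if its sumset `A * A` is larger than its
difference set `A / A = {a₁ * a₂⁻¹}`. -/
def IsMSTD {G : Type*} [Group G] [DecidableEq G] (A : Finset G) : Prop :=
  (A / A).card < (A * A).card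

/-- A finset of a group is MDTS if its sumset is smaller than its difference set. -/
def IsMDTS {G : Type*} [Group G] [DecidableEq G] (A : Finset G) : Prop :=
  (A * A).card < (A / A).card

/-- A finset of a group is balanced if its sumset and difference set have equal size. -/
def IsBalanced {G : Type*} [Group G] [DecidableEq G] (A : Finset G) : Prop :=
  (A * A).card = (A / A).card

theorem card_pair_div_pair {G : Type*} [Group G] [DecidableEq G] {x y : G} (h : x ≠ y) :
    (({x, y} : Finset G) / {x, y}).card = if x / y = y / x then 2 else 3 := by
  have hxy : (1 : G) ≠ x / y := fun e => h (div_eq_one.1 e.symm)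
  have hyx : (1 : G) ≠ y / x := fun e => h (div_eq_one.1 e.symm).symm
  have key : ({x, y} : Finset G) / {x, y} = {1, x / y, y / x} := by
    ext z
    simp only [mem_div, mem_insert, mem_singleton, exists_eq_or_imp, exists_eq_left, div_self']
    grind
  rw [key]
  split_ifs with hd
  · rw [← hd, pair_eq_singleton, card_pair hxy]
  · exact card_eq_three.2 ⟨1, x / y, y / x, hxy, hyx, hd, rfl⟩

theorem isBalanced_pair_of_commute {G : Type*} [Group G] [DecidableEq G] {x y : G} (h : x ≠ y)
    (hc : Commute x y) : IsBalanced ({x, y} : Finset G) := by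
  have h₁ : x * x ≠ x * y := fun e => h (mul_left_cancel e)
  have h₂ : x * y ≠ y * y := fun e => h (mul_right_cancel e)
  have key : ({x, y} : Finset G) * {x, y} = {x * x, x * y, y * y} := by
    ext z
    simp only [mem_mul, mem_insert, mem_singleton, exists_eq_or_imp, exists_eq_left, ← hc.eq]
    grind
  have hiff : x / y = y / x ↔ x * x = y * y := by
    have e₁ : x / y * (x * y) = x * x := by rw [hc.eq, ← mul_assoc, div_mul_cancel]
    have e₂ : y / x * (x * y) = y * y := by rw [← mul_assoc, div_mul_cancel]
    rw [← mul_left_inj (x * y), e₁, e₂]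
  rw [IsBalanced, card_pair_div_pair h, key]
  simp only [hiff]
  split_ifs with hd
  · rw [← hd, insert_eq_of_mem (by simp), card_pair h₁.symm]
  · exact card_eq_three.2 ⟨_, _, _, h₁, hd, h₂, rfl⟩

theorem isBalanced_pair_of_mul_self_eq {G : Type*} [Group G] [DecidableEq G] {x y : G}
    (hs : x * x = y * y) : IsBalanced ({x, y} : Finset G) := by
  have e₁ : x / y * (y * y) = x * y := by rw [← mul_assoc, div_mul_cancel]
  have e₂ : y / x * (y * y) = y * x := by rw [← hs, ← mul_assoc, div_mul_cancel]
  have key : ({x, y} : Finset G) * {x, y} =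
      (({x, y} : Finset G) / {x, y}).map (mulRightEmbedding (y * y)) := by
    ext z
    simp only [mem_mul, mem_div, mem_map, mem_insert, mem_singleton, exists_eq_left,
      or_and_right, exists_or, mulRightEmbedding_apply, div_self']
    grind
  rw [IsBalanced, key, card_map]

namespace QuaternionGroup

theorem isBalanced_pair_a {n : ℕ} {i j : ZMod (2 * n)} (h : i ≠ j) :
    IsBalanced ({a i, a j} : Finset (QuaternionGroup n)) :=
  isBalanced_pair_of_commute (fun e => h (a.inj e)) (by
    rw [commute_iff_eq, a_mul_a, a_mul_a, add_comm])

theorem isBalanced_pair_xa {n : ℕ} (i j : ZMod (2 * n)) :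
    IsBalanced ({xa i, xa j} : Finset (QuaternionGroup n)) :=
  isBalanced_pair_of_mul_self_eq (by simp)

theorem natCast_ne_zero {n : ℕ} (hn : n ≠ 0) : (n : ZMod (2 * n)) ≠ 0 := by
  rw [Ne, ZMod.natCast_eq_zero_iff]
  intro h
  have := Nat.le_of_dvd (by omega) h
  omega

theorem add_self_ne_natCast {n : ℕ} (hodd : Odd n) (i : ZMod (2 * n)) : i + i ≠ n := by
  intro h
  have h' := congrArg (ZMod.castHom (dvd_mul_right 2 n) (ZMod 2)) h
  rw [map_add, map_natCast, CharTwo.add_self_eq_zero, ZMod.natCast_eq_one_iff_odd.2 hodd] at h'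
  exact zero_ne_one h'

theorem add_self_eq_zero_iff {n : ℕ} (hn : n ≠ 0) (i : ZMod (2 * n)) :
    i + i = 0 ↔ i = 0 ∨ i = n := by
  have : NeZero n := ⟨hn⟩
  rw [← neg_eq_iff_add_eq_zero, ZMod.neg_eq_self_iff]
  refine or_congr_right ⟨fun h => ?_, ?_⟩
  · rw [← ZMod.natCast_zmod_val i, Nat.eq_of_mul_eq_mul_left two_pos h]
  · rintro rfl
    rw [ZMod.val_natCast_of_lt (by omega)]

theorem card_pair_a_xa_div {n : ℕ} (hn : n ≠ 0) (i j : ZMod (2 * n)) :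
    (({a i, xa j} : Finset (QuaternionGroup n)) / {a i, xa j}).card = 3 := by
  rw [card_pair_div_pair (by simp), if_neg]
  have hinv : (xa j : QuaternionGroup n)⁻¹ = xa ((n : ZMod (2 * n)) + j) := rfl
  have hinv' : (a i : QuaternionGroup n)⁻¹ = a (-i) := rfl
  rw [div_eq_mul_inv, div_eq_mul_inv, hinv, hinv', a_mul_xa, xa_mul_a]
  intro h
  apply natCast_ne_zero hn
  have := xa.inj h
  linear_combination this

theorem card_pair_a_xa_mul {n : ℕ} (hodd : Odd n) (i j : ZMod (2 * n)) :
    (({a i, xa j} : Finset (QuaternionGroup n)) * {a i, xa j}).card =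
      if i + i = 0 then 3 else 4 := by
  have key : ({a i, xa j} : Finset (QuaternionGroup n)) * {a i, xa j} =
      {a (i + i), a n, xa (j - i), xa (j + i)} := by
    ext z
    simp only [mem_mul, mem_insert, mem_singleton, exists_eq_or_imp, exists_eq_left, a_mul_a,
      a_mul_xa, xa_mul_a, xa_mul_xa, add_sub_cancel_right]
    grind
  have hiff : j - i = j + i ↔ i + i = 0 :=
    ⟨fun h => by linear_combination -h, fun h => by linear_combination -h⟩
  rw [key, card_insert_of_notMem (by simp [add_self_ne_natCast hodd i]),
    card_insert_of_notMem (by simp)]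
  split_ifs with h
  · rw [hiff.2 h, pair_eq_singleton, card_singleton]
  · rw [card_pair (fun e => h (hiff.1 (xa.inj e)))]

theorem isMSTD_pair_a_xa_iff {n : ℕ} (hodd : Odd n) (i j : ZMod (2 * n)) :
    IsMSTD ({a i, xa j} : Finset (QuaternionGroup n)) ↔ i + i ≠ 0 := by
  rw [IsMSTD, card_pair_a_xa_div hodd.pos.ne', card_pair_a_xa_mul hodd]
  split_ifs with h <;> simp [h]

theorem isBalanced_or_eq_pair_a_xa {n : ℕ} {A : Finset (QuaternionGroup n)} (hA : A.card = 2) :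
    IsBalanced A ∨ ∃ i j, A = {a i, xa j} := by
  obtain ⟨x, y, hxy, rfl⟩ := card_eq_two.1 hA
  rcases x with i | i <;> rcases y with j | j
  · exact .inl (isBalanced_pair_a fun h => hxy (congrArg a h))
  · exact .inr ⟨i, j, rfl⟩
  · exact .inr ⟨j, i, pair_comm _ _⟩
  · exact .inl (isBalanced_pair_xa i j)

theorem not_isMDTS_of_card_eq_two {n : ℕ} (hodd : Odd n) {A : Finset (QuaternionGroup n)}
    (hA : A.card = 2) : ¬ IsMDTS A := by
  rcases isBalanced_or_eq_pair_a_xa hA with h | ⟨i, j, rfl⟩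
  · exact h.not_lt
  · rw [IsMDTS, card_pair_a_xa_div hodd.pos.ne', card_pair_a_xa_mul hodd]
    split_ifs <;> simp

theorem pair_a_xa_injective {n : ℕ} : Function.Injective
    fun p : ZMod (2 * n) × ZMod (2 * n) => ({a p.1, xa p.2} : Finset (QuaternionGroup n)) := by
  rintro ⟨i, j⟩ ⟨k, l⟩ h
  have h₁ := congrArg (a i ∈ ·) h
  have h₂ := congrArg (xa j ∈ ·) h
  simp only [mem_insert, mem_singleton, a.injEq, xa.injEq, reduceCtorEq, or_false, false_or,
    or_true] at h₁ h₂
  rw [h₁.mp trivial, h₂.mp trivial]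

theorem ncard_isMSTD_card_eq_two {n : ℕ} (hodd : Odd n) :
    {A : Finset (QuaternionGroup n) | A.card = 2 ∧ IsMSTD A}.ncard = 4 * n * (n - 1) := by
  have hn := hodd.pos.ne'
  have : NeZero n := ⟨hn⟩
  have key : {A : Finset (QuaternionGroup n) | A.card = 2 ∧ IsMSTD A} =
      (fun p : ZMod (2 * n) × ZMod (2 * n) => ({a p.1, xa p.2} : Finset (QuaternionGroup n))) ''
        (({0, (n : ZMod (2 * n))}ᶜ ×ˢ univ : Finset (ZMod (2 * n) × ZMod (2 * n))) : Set _) := by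
    ext A
    simp only [Set.mem_ofPred_eq, Set.mem_image, mem_coe, mem_product, mem_compl, mem_insert,
      mem_singleton, mem_univ, and_true, ← add_self_eq_zero_iff hn]
    constructor
    · rintro ⟨hA, hM⟩
      rcases isBalanced_or_eq_pair_a_xa hA with h | ⟨i, j, rfl⟩
      · exact absurd h hM.ne'
      · exact ⟨(i, j), (isMSTD_pair_a_xa_iff hodd i j).1 hM, rfl⟩
    · rintro ⟨⟨i, j⟩, h, rfl⟩
      exact ⟨card_pair (by simp), (isMSTD_pair_a_xa_iff hodd i j).2 h⟩
  rw [key, Set.ncard_image_of_injective _ pair_a_xa_injective, Set.ncard_coe_finset, card_product,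
    card_compl, card_pair (natCast_ne_zero hn).symm, card_univ, ZMod.card,
    show 2 * n - 2 = 2 * (n - 1) by omega]
  ring

theorem ncard_card_eq_two {n : ℕ} (hn : n ≠ 0) :
    {A : Finset (QuaternionGroup n) | A.card = 2}.ncard = 2 * n * (4 * n - 1) := by
  have : NeZero n := ⟨hn⟩
  have key : {A : Finset (QuaternionGroup n) | A.card = 2} =
      (powersetCard 2 (univ : Finset (QuaternionGroup n)) : Set _) := by
    ext A
    simp [mem_powersetCard]
  rw [key, Set.ncard_coe_finset, card_powersetCard, card_univ, card, Nat.choose_two_right,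
    show 4 * n * (4 * n - 1) = 2 * (2 * n * (4 * n - 1)) by ring, Nat.mul_div_cancel_left _ two_pos]

theorem ncard_isBalanced_card_eq_two {n : ℕ} (hodd : Odd n) :
    {A : Finset (QuaternionGroup n) | A.card = 2 ∧ IsBalanced A}.ncard =
      2 * n * (2 * n + 1) := by
  have hn := hodd.pos.ne'
  have : NeZero n := ⟨hn⟩
  have key : {A : Finset (QuaternionGroup n) | A.card = 2} =
      {A | A.card = 2 ∧ IsMSTD A} ∪ {A | A.card = 2 ∧ IsBalanced A} := by
    ext A
    simp only [Set.mem_union, Set.mem_ofPred_eq, ← and_or_left]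
    refine ⟨fun hA => ⟨hA, ?_⟩, And.left⟩
    have := not_isMDTS_of_card_eq_two hodd hA
    simp only [IsMDTS, IsMSTD, IsBalanced] at *
    omega
  have hdisj : Disjoint {A : Finset (QuaternionGroup n) | A.card = 2 ∧ IsMSTD A}
      {A | A.card = 2 ∧ IsBalanced A} :=
    Set.disjoint_left.2 fun A h₁ h₂ => h₁.2.ne' h₂.2
  have htotal := ncard_card_eq_two hn
  rw [key, Set.ncard_union_eq hdisj, ncard_isMSTD_card_eq_two hodd] at htotal
  obtain ⟨m, rfl⟩ := Nat.exists_eq_succ_of_ne_zero hn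
  rw [show 4 * m.succ - 1 = 4 * m + 3 by omega, Nat.succ_sub_one, Nat.succ_eq_add_one] at htotal
  rw [Nat.succ_eq_add_one]
  linarith

end QuaternionGroup

theorem stmt_1 (n : ℕ) (hn : 2 ≤ n) (hodd : Odd n) :
    {A : Finset (QuaternionGroup n) | A.card = 2 ∧ IsMSTD A}.ncard = 4 * n * (n - 1) ∧
    {A : Finset (QuaternionGroup n) | A.card = 2 ∧ IsMDTS A}.ncard = 0 ∧
    {A : Finset (QuaternionGroup n) | A.card = 2 ∧ IsBalanced A}.ncard = 2 * n * (2 * n + 1) := by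
  refine ⟨QuaternionGroup.ncard_isMSTD_card_eq_two hodd, ?_,
    QuaternionGroup.ncard_isBalanced_card_eq_two hodd⟩
  have hempty : {A : Finset (QuaternionGroup n) | A.card = 2 ∧ IsMDTS A} = ∅ :=
    Set.eq_empty_of_forall_notMem fun A hA =>
      QuaternionGroup.not_isMDTS_of_card_eq_two hodd hA.1 hA.2
  rw [hempty, Set.ncard_empty]
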